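/- arXiv:1212.1958 — 4 statements merged into one kernel-verified Lean document; each statement's English description precedes it below -/
import Mathlib

section
/- Let p be a prime and e ≥ 1 an integer. The group of units (ℤ/p^eℤ)ˣ acts freely by scalar multiplication λ·(a, b) = (λa, λb) on the set of pairs (a, b) ∈ (ℤ/p^eℤ)² with a or b a unit, and the number of orbits of this action is p^e + p^(e−1). In other words, the projective line over ℤ/p^eℤ has exactly p^e + p^(e−1) points. -/
/-- Two coprime pairs over `R` span the same point of the projective line when they differ by a
unit: each orbit has exactly one representative of the form `(x, 1)`, or `(1, y)` with `y` not
a unit. -/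
noncomputable def unimodularOrbitsEquiv (R : Type*) [CommRing R] :
    Quot (fun x y : {v : R × R // IsUnit v.1 ∨ IsUnit v.2} =>
      ∃ u : Rˣ, (u : R) * x.1.1 = y.1.1 ∧ (u : R) * x.1.2 = y.1.2) ≃
      R ⊕ {y : R // ¬ IsUnit y} where
  toFun := Quot.lift
    (fun x => open Classical in
      if h : IsUnit x.1.2 then .inl (x.1.1 * Ring.inverse x.1.2)
      else .inr ⟨x.1.2 * Ring.inverse x.1.1, fun hu => h (isUnit_of_mul_isUnit_left hu)⟩)
    (by
      rintro ⟨⟨a, b⟩, hx⟩ ⟨⟨_, _⟩, hy⟩ ⟨u, rfl, rfl⟩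
      have key (c d : R) : u * c * Ring.inverse (u * d) = c * Ring.inverse d := by
        rw [Ring.mul_inverse_rev, Ring.inverse_unit]
        linear_combination c * Ring.inverse d * u.mul_inv
      by_cases hb : IsUnit b <;> simp [hb, key])
  invFun := Sum.elim (fun x => Quot.mk _ ⟨(x, 1), .inr isUnit_one⟩)
    (fun y => Quot.mk _ ⟨(1, y.1), .inl isUnit_one⟩)
  left_inv := by
    rintro ⟨⟨a, b⟩, hab⟩
    by_cases hb : IsUnit b
    · obtain ⟨u, rfl⟩ := hb
      simp only [Units.isUnit, dite_true, Sum.elim_inl]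
      refine Quot.sound ⟨u, ?_, mul_one _⟩
      rw [Ring.inverse_unit]
      linear_combination a * u.mul_inv
    · obtain ⟨u, rfl⟩ := hab.resolve_right hb
      simp only [hb, dite_false, Sum.elim_inr]
      refine Quot.sound ⟨u, mul_one _, ?_⟩
      rw [Ring.inverse_unit]
      linear_combination b * u.mul_inv
  right_inv := by
    rintro (x | ⟨y, hy⟩)
    · simp
    · simp [hy]

theorem ZMod.card_not_isUnit_prime_pow {p : ℕ} (hp : p.Prime) {e : ℕ} (he : 1 ≤ e) :
    Nat.card {y : ZMod (p ^ e) // ¬ IsUnit y} = p ^ (e - 1) := by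
  have : NeZero (p ^ e) := ⟨pow_ne_zero _ hp.ne_zero⟩
  have hunits : Nat.card {y : ZMod (p ^ e) // IsUnit y} = p ^ (e - 1) * (p - 1) := by
    rw [← Nat.totient_prime_pow hp he, ← ZMod.card_units_eq_totient, ← Nat.card_eq_fintype_card]
    exact Nat.card_congr Submonoid.unitsTypeEquivIsUnitSubmonoid.symm.toEquiv
  have hsum : Nat.card {y : ZMod (p ^ e) // IsUnit y} +
      Nat.card {y : ZMod (p ^ e) // ¬ IsUnit y} = p ^ e := by
    classical
    rw [← Nat.card_sum, Nat.card_congr (Equiv.sumCompl _), Nat.card_zmod]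
  obtain ⟨k, rfl⟩ := Nat.exists_eq_add_of_le' he
  obtain ⟨q, rfl⟩ := Nat.exists_eq_add_of_le' hp.one_le
  simp only [Nat.add_sub_cancel] at *
  rw [hunits, pow_succ, mul_add_one] at hsum
  exact Nat.add_left_cancel hsum

/-- The unit group `(ℤ/p^eℤ)ˣ` acts freely by scaling on the set of pairs
`(a, b)` modulo `p^e` with `a` or `b` a unit, and the quotient by this
action (the projective line over `ℤ/p^eℤ`) has exactly `p^e + p^(e-1)`
points. -/
theorem stmt_8 (p : ℕ) (hp : p.Prime) (e : ℕ) (he : 1 ≤ e) :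
    (∀ (u : (ZMod (p ^ e))ˣ) (a b : ZMod (p ^ e)), (IsUnit a ∨ IsUnit b) →
      (u : ZMod (p ^ e)) * a = a ∧ (u : ZMod (p ^ e)) * b = b → u = 1) ∧
    Nat.card (Quot (fun x y : {v : ZMod (p ^ e) × ZMod (p ^ e) // IsUnit v.1 ∨ IsUnit v.2} =>
        ∃ u : (ZMod (p ^ e))ˣ,
          (u : ZMod (p ^ e)) * x.1.1 = y.1.1 ∧ (u : ZMod (p ^ e)) * x.1.2 = y.1.2)) =
      p ^ e + p ^ (e - 1) := by
  have : NeZero (p ^ e) := ⟨pow_ne_zero _ hp.ne_zero⟩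
  refine ⟨?_, ?_⟩
  · rintro u a b (h | h) ⟨ha, hb⟩
    · exact Units.ext (h.mul_right_cancel (ha.trans (one_mul a).symm))
    · exact Units.ext (h.mul_right_cancel (hb.trans (one_mul b).symm))
  · rw [Nat.card_congr (unimodularOrbitsEquiv (ZMod (p ^ e))), Nat.card_sum, Nat.card_zmod,
      ZMod.card_not_isUnit_prime_pow hp he]
end

section
/- Let p be a prime, f, g integer polynomials, and r an integer with p ∤ g(r). Define the rotated polynomial f_{u,v}(x) = f(x) + (u·x + v)·g(x). Then for integers u, v: there exists v such that both f_{u,v}(r) ≡ 0 (mod p) and f'_{u,v}(r) ≡ 0 (mod p) if and only if u·g(r)² ≡ f(r)·g'(r) − f'(r)·g(r) (mod p). Consequently there is exactly one residue class of u modulo p for which r is a multiple root of f_{u,v} modulo p for some v. -/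
open Polynomial

/-- The rotation of `f` by `ux + v` with respect to `g`:
`f_{u,v}(x) = f(x) + (u·x + v)·g(x)`. -/
noncomputable def rot (f g : Polynomial ℤ) (u v : ℤ) : Polynomial ℤ :=
  f + (C u * X + C v) * g

theorem derivative_rot (f g : Polynomial ℤ) (u v : ℤ) :
    derivative (rot f g u v) =
      derivative f + (C u * g + (C u * X + C v) * derivative g) := by
  simp [rot]

theorem exists_double_root_iff {K : Type*} [Field K] {a b a' b' : K} (hb : b ≠ 0) (u r : K) :
    (∃ v : K, a + (u * r + v) * b = 0 ∧ a' + (u * b + (u * r + v) * b') = 0) ↔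
      u * b ^ 2 = a * b' - a' * b := by
  constructor
  · rintro ⟨v, h, h'⟩
    linear_combination b * h' - b' * h
  · intro h
    refine ⟨-a / b - u * r, by field_simp; ring, ?_⟩
    field_simp
    linear_combination h

theorem exists_multiple_root_rot_iff (p : ℕ) [Fact p.Prime] (f g : Polynomial ℤ) (r : ℤ)
    (hg : ((g.eval r : ℤ) : ZMod p) ≠ 0) (u : ℤ) :
    (∃ v : ℤ, (p : ℤ) ∣ (rot f g u v).eval r ∧ (p : ℤ) ∣ (derivative (rot f g u v)).eval r) ↔
      (u : ZMod p) * (g.eval r : ℤ) ^ 2 =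
        (f.eval r : ℤ) * ((derivative g).eval r : ℤ) -
          ((derivative f).eval r : ℤ) * (g.eval r : ℤ) := by
  rw [← exists_double_root_iff hg u r, (ZMod.intCast_surjective (n := p)).exists]
  simp only [← ZMod.intCast_zmod_eq_zero_iff_dvd, derivative_rot]
  simp [rot]

/-- For `p ∤ g(r)`, there is a `v` making `r` a multiple root of `f_{u,v}`
modulo `p` iff `u·g(r)² ≡ f(r)·g'(r) - f'(r)·g(r) (mod p)`; hence exactly
one residue class of `u` modulo `p` admits `r` as a multiple root. -/
theorem stmt_11 (p : ℕ) (hp : p.Prime) (f g : Polynomial ℤ) (r : ℤ)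
    (hg : ¬ (p : ℤ) ∣ g.eval r) :
    (∀ u : ℤ,
      (∃ v : ℤ, (p : ℤ) ∣ (rot f g u v).eval r ∧
          (p : ℤ) ∣ (Polynomial.derivative (rot f g u v)).eval r) ↔
        u * (g.eval r) ^ 2 ≡
          f.eval r * (Polynomial.derivative g).eval r -
            (Polynomial.derivative f).eval r * g.eval r [ZMOD (p : ℤ)]) ∧
    ∃! u₀ : ZMod p, ∀ u : ℤ,
      (∃ v : ℤ, (p : ℤ) ∣ (rot f g u v).eval r ∧
          (p : ℤ) ∣ (Polynomial.derivative (rot f g u v)).eval r) ↔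
        (u : ZMod p) = u₀ := by
  have := Fact.mk hp
  have hg' : ((g.eval r : ℤ) : ZMod p) ≠ 0 := by
    rwa [Ne, ZMod.intCast_zmod_eq_zero_iff_dvd]
  have hiff := exists_multiple_root_rot_iff p f g r hg'
  refine ⟨fun u => ?_, ?_⟩
  · rw [hiff, ← ZMod.intCast_eq_intCast_iff]
    push_cast
    rfl
  · simp only [hiff, ← eq_div_iff (pow_ne_zero 2 hg')]
    refine ⟨_, fun u => Iff.rfl, fun w hw => ?_⟩
    obtain ⟨u, rfl⟩ := ZMod.intCast_surjective w
    exact (hw u).2 rfl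
end

section
/- Let p be a prime, k ≥ 1, f, g integer polynomials, u, v, r integers with f_{u,v}(r) ≡ 0 (mod p^k), where f_{u,v}(x) = f(x) + (u·x + v)·g(x). Then for all integers i, j: f_{u+i·p^k, v+j·p^k}(r) ≡ 0 (mod p^(k+1)) if and only if (i·r + j)·g(r) + f_{u,v}(r)/p^k ≡ 0 (mod p). In particular, the set of pairs (i, j) modulo p for which r lifts to a root modulo p^(k+1) of the rotated polynomial is the solution set of a linear congruence modulo p. -/
open Polynomial

theorem eval_rot_add_mul (f g : Polynomial ℤ) (u v i j q r : ℤ) :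
    (rot f g (u + i * q) (v + j * q)).eval r =
      (rot f g u v).eval r + q * ((i * r + j) * g.eval r) := by
  simp only [rot, eval_add, eval_mul, eval_C, eval_X]
  ring

/-- If `f_{u,v}(r) ≡ 0 (mod p^k)`, then `r` is a root of
`f_{u+i·p^k, v+j·p^k}` modulo `p^(k+1)` iff `(i, j)` satisfies the linear
congruence `(i·r + j)·g(r) + f_{u,v}(r)/p^k ≡ 0 (mod p)`. -/
theorem stmt_12 (p : ℕ) (hp : p.Prime) (k : ℕ) (hk : 1 ≤ k)
    (f g : Polynomial ℤ) (u v r : ℤ)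
    (hroot : (p : ℤ) ^ k ∣ (rot f g u v).eval r) :
    ∀ i j : ℤ,
      (p : ℤ) ^ (k + 1) ∣
          (rot f g (u + i * (p : ℤ) ^ k) (v + j * (p : ℤ) ^ k)).eval r ↔
        (p : ℤ) ∣ ((i * r + j) * g.eval r + (rot f g u v).eval r / (p : ℤ) ^ k) := by
  intro i j
  have hpk : (p : ℤ) ^ k ≠ 0 := pow_ne_zero k (Int.natCast_ne_zero.mpr hp.ne_zero)
  rw [eval_rot_add_mul, pow_succ]
  obtain ⟨m, hm⟩ := hroot
  rw [hm, Int.mul_ediv_cancel_left _ hpk, ← mul_add, mul_dvd_mul_iff_left hpk, add_comm]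
end

section
/- (Canfield–Erdős–Pomerance) Let Ψ(x, y) denote the number of positive integers n ≤ x all of whose prime factors are at most y. For every fixed ε with 0 < ε < 1 the following holds: for every δ > 0 there exist u₀ and y₀ such that for all real u ≥ u₀ and all real x with x^(1/u) ≥ y₀ and x ≥ u^(u/(1−ε)), one has | log(x / Ψ(x, x^(1/u))) / (u·log u) − 1 | ≤ δ. Equivalently, Ψ(x, x^(1/u)) = x·u^(−u(1+o(1))) as u → ∞ and x^(1/u) → ∞, uniformly in the region x ≥ u^(u/(1−ε)). -/
/-- `smoothCount x y` is `Ψ(x, y)`, the number of positive integers `n ≤ x`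
all of whose prime factors are at most `y`. -/
noncomputable def smoothCount (x y : ℝ) : ℕ :=
  Nat.card {n : ℕ // 0 < n ∧ (n : ℝ) ≤ x ∧ ∀ q : ℕ, q.Prime → q ∣ n → (q : ℝ) ≤ y}

open Finset ArithmeticFunction

theorem sum_Ioc_filter_dvd (F : ℕ → ℝ) (N : ℕ) {q : ℕ} (hq : 0 < q) :
    ∑ n ∈ Ioc 0 N with q ∣ n, F n = ∑ m ∈ Ioc 0 (N / q), F (q * m) := by
  symm
  refine Finset.sum_bij (fun m _ => q * m) ?_ ?_ ?_ (fun _ _ => rfl)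
  · intro m hm
    rw [Finset.mem_Ioc] at hm
    rw [Finset.mem_filter, Finset.mem_Ioc]
    exact ⟨⟨Nat.mul_pos hq hm.1, by
      rw [mul_comm]; exact (Nat.le_div_iff_mul_le hq).1 hm.2⟩, Nat.dvd_mul_right _ _⟩
  · intro a _ b _ h
    exact Nat.eq_of_mul_eq_mul_left hq h
  · rintro n hn
    rw [Finset.mem_filter, Finset.mem_Ioc] at hn
    obtain ⟨⟨h0, hN⟩, m, rfl⟩ := hn
    refine ⟨m, Finset.mem_Ioc.2 ⟨Nat.pos_of_mul_pos_left h0, ?_⟩, rfl⟩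
    rw [Nat.le_div_iff_mul_le hq, mul_comm]; exact hN

theorem log_factorial_eq_sum_vonMangoldt (N : ℕ) :
    Real.log N.factorial = ∑ d ∈ Ioc 0 N, vonMangoldt d * (N / d : ℕ) := by
  rw [← sum_Ioc_mul_zeta_eq_sum, vonMangoldt_mul_zeta]
  induction N with
  | zero => simp
  | succ N ih =>
    rw [Finset.sum_Ioc_succ_top (Nat.zero_le N), Nat.factorial_succ, Nat.cast_mul,
      Real.log_mul (by positivity) (by positivity), ih, log_apply, add_comm]

theorem sum_vonMangoldt_div_le {N : ℕ} (hN : 0 < N) :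
    ∑ d ∈ Ioc 0 N, vonMangoldt d / d ≤ Real.log N + (Real.log 4 + 4) := by
  have hN' : (0 : ℝ) < N := by exact_mod_cast hN
  have hup : Real.log N.factorial ≤ N * Real.log N := by
    rw [← Real.log_pow]
    exact Real.log_le_log (by exact_mod_cast N.factorial_pos)
      (by exact_mod_cast N.factorial_le_pow)
  have hpsi : ∑ d ∈ Ioc 0 N, vonMangoldt d ≤ (Real.log 4 + 4) * N := by
    simpa [Chebyshev.psi] using Chebyshev.psi_le_const_mul_self hN'.le
  have hlow : N * ∑ d ∈ Ioc 0 N, vonMangoldt d / d - ∑ d ∈ Ioc 0 N, vonMangoldt d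
      ≤ Real.log N.factorial := by
    rw [log_factorial_eq_sum_vonMangoldt, Finset.mul_sum, ← Finset.sum_sub_distrib]
    refine Finset.sum_le_sum fun d _ => ?_
    have h : (N : ℝ) / d - 1 ≤ (N / d : ℕ) := by
      rw [← Nat.floor_div_eq_div (K := ℝ)]
      linarith [Nat.lt_floor_add_one ((N : ℝ) / d)]
    calc N * (vonMangoldt d / d) - vonMangoldt d = vonMangoldt d * ((N : ℝ) / d - 1) := by ring
      _ ≤ _ := mul_le_mul_of_nonneg_left h vonMangoldt_nonneg
  refine le_of_mul_le_mul_left ?_ hN'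
  linarith

theorem log_sub_one_le_sum_vonMangoldt_div {N : ℕ} (hN : 0 < N) :
    Real.log N - 1 ≤ ∑ d ∈ Ioc 0 N, vonMangoldt d / d := by
  have hN' : (0 : ℝ) < N := by exact_mod_cast hN
  have hlow : N * Real.log N - N ≤ Real.log N.factorial := by
    have h := Stirling.le_log_factorial_stirling hN.ne'
    have h1 : 0 ≤ Real.log N := Real.log_natCast_nonneg N
    have h2 : 0 ≤ Real.log (2 * Real.pi) := Real.log_nonneg (by linarith [Real.pi_gt_three])
    linarith
  have hup : Real.log N.factorial ≤ N * ∑ d ∈ Ioc 0 N, vonMangoldt d / d := by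
    rw [log_factorial_eq_sum_vonMangoldt, Finset.mul_sum]
    refine Finset.sum_le_sum fun d _ => ?_
    calc vonMangoldt d * (N / d : ℕ) ≤ vonMangoldt d * ((N : ℝ) / d) :=
          mul_le_mul_of_nonneg_left Nat.cast_div_le vonMangoldt_nonneg
      _ = _ := by ring
  refine le_of_mul_le_mul_left ?_ hN'
  linarith

theorem le_sum_vonMangoldt_div_Ioc {a b : ℝ} (ha : 1 ≤ a) (hab : a ≤ b) :
    Real.log b - Real.log a - 11 ≤ ∑ d ∈ Ioc ⌊a⌋₊ ⌊b⌋₊, vonMangoldt d / d := by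
  have hfa : 0 < ⌊a⌋₊ := Nat.floor_pos.2 ha
  have hfb : 0 < ⌊b⌋₊ := Nat.floor_pos.2 (ha.trans hab)
  have h1 := sum_vonMangoldt_div_le hfa
  have h2 := log_sub_one_le_sum_vonMangoldt_div hfb
  rw [← Finset.sum_Ioc_consecutive _ (Nat.zero_le _) (Nat.floor_le_floor hab)] at h2
  have h3 : Real.log ⌊a⌋₊ ≤ Real.log a :=
    Real.log_le_log (by exact_mod_cast hfa) (Nat.floor_le (by linarith))
  have h4 : Real.log b ≤ Real.log 2 + Real.log ⌊b⌋₊ := by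
    rw [← Real.log_mul (by norm_num) (by exact_mod_cast hfb.ne')]
    refine Real.log_le_log (by linarith) ?_
    have : (1 : ℝ) ≤ ⌊b⌋₊ := by exact_mod_cast hfb
    linarith [Nat.lt_floor_add_one b]
  have h5 : Real.log 4 = 2 * Real.log 2 := by
    rw [show (4 : ℝ) = 2 ^ 2 by norm_num, Real.log_pow]; norm_num
  linarith [Real.log_two_lt_d9]

theorem sum_log_prime_div_le {y : ℝ} (hy : 1 ≤ y) :
    ∑ p ∈ Nat.primesLE ⌊y⌋₊, Real.log p / p ≤ Real.log y + 6 := by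
  have hf : 0 < ⌊y⌋₊ := Nat.floor_pos.2 hy
  have h1 := sum_vonMangoldt_div_le hf
  have h3 : Real.log ⌊y⌋₊ ≤ Real.log y :=
    Real.log_le_log (by exact_mod_cast hf) (Nat.floor_le (by linarith))
  have h2 : ∑ p ∈ Nat.primesLE ⌊y⌋₊, Real.log p / p
      ≤ ∑ d ∈ Ioc 0 ⌊y⌋₊, vonMangoldt d / d := by
    rw [Nat.primesLE_eq_filter_Ioc_zero, Finset.sum_filter]
    refine Finset.sum_le_sum fun d _ => ?_
    split_ifs with hd
    · rw [vonMangoldt_apply_prime hd]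
    · exact div_nonneg vonMangoldt_nonneg (Nat.cast_nonneg _)
  have h5 : Real.log 4 = 2 * Real.log 2 := by
    rw [show (4 : ℝ) = 2 ^ 2 by norm_num, Real.log_pow]; norm_num
  linarith [Real.log_two_lt_d9]

/-- `n` is `y`-smooth: all prime factors of `n` are at most `y`. -/
def IsSmooth (y : ℝ) (n : ℕ) : Prop := ∀ q : ℕ, q.Prime → q ∣ n → (q : ℝ) ≤ y

theorem IsSmooth.mul {y : ℝ} {m n : ℕ} (hm : IsSmooth y m) (hn : IsSmooth y n) :
    IsSmooth y (m * n) := fun q hq h => (hq.dvd_mul.1 h).elim (hm q hq) (hn q hq)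

theorem isSmooth_of_le {y : ℝ} {n : ℕ} (hn : 0 < n) (h : (n : ℝ) ≤ y) : IsSmooth y n :=
  fun _ _ hq => le_trans (by exact_mod_cast Nat.le_of_dvd hn hq) h

open Classical in
/-- The finite set of positive `y`-smooth integers up to `x`. -/
noncomputable def smoothFinset (x y : ℝ) : Finset ℕ := {n ∈ Ioc 0 ⌊x⌋₊ | IsSmooth y n}

theorem mem_smoothFinset {x y : ℝ} {n : ℕ} :
    n ∈ smoothFinset x y ↔ 0 < n ∧ (n : ℝ) ≤ x ∧ IsSmooth y n := by
  classical
  rw [smoothFinset, Finset.mem_filter, Finset.mem_Ioc, and_assoc]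
  refine and_congr_right fun hn => and_congr_left fun _ => ?_
  exact Nat.le_floor_iff' hn.ne'

theorem smoothCount_eq_card (x y : ℝ) : smoothCount x y = #(smoothFinset x y) :=
  Nat.subtype_card _ fun _ => mem_smoothFinset

theorem smoothCount_pos {x : ℝ} (hx : 1 ≤ x) (y : ℝ) : 0 < smoothCount x y := by
  rw [smoothCount_eq_card, Finset.card_pos]
  refine ⟨1, mem_smoothFinset.2 ⟨one_pos, by simpa using hx, fun q hq h => ?_⟩⟩
  exact absurd (Nat.dvd_one.1 h) hq.one_lt.ne'

theorem sum_vonMangoldt_mul_smoothCount_le (x y : ℝ) :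
    ∑ d ∈ Ioc 0 ⌊y⌋₊, vonMangoldt d * smoothCount (x / d) y
      ≤ smoothCount x y * Real.log x := by
  have hlog : ∑ n ∈ smoothFinset x y, Real.log n ≤ smoothCount x y * Real.log x := by
    rw [smoothCount_eq_card, ← nsmul_eq_mul]
    refine Finset.sum_le_card_nsmul _ _ _ fun n hn => ?_
    obtain ⟨h0, hn, -⟩ := mem_smoothFinset.1 hn
    exact Real.log_le_log (by exact_mod_cast h0) hn
  refine le_trans ?_ hlog
  have hdiv : ∀ n ∈ smoothFinset x y,
      ∑ d ∈ Ioc 0 ⌊y⌋₊, (if d ∣ n then vonMangoldt d else 0) ≤ Real.log n := by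
    intro n hn
    obtain ⟨h0, -, -⟩ := mem_smoothFinset.1 hn
    rw [← vonMangoldt_sum, ← Finset.sum_filter]
    refine Finset.sum_le_sum_of_subset_of_nonneg ?_ fun _ _ _ => vonMangoldt_nonneg
    intro d hd
    exact Nat.mem_divisors.2 ⟨(Finset.mem_filter.1 hd).2, h0.ne'⟩
  refine le_trans ?_ (Finset.sum_le_sum hdiv)
  rw [Finset.sum_comm]
  refine Finset.sum_le_sum fun d hd => ?_
  rw [Finset.mem_Ioc] at hd
  rw [← Finset.sum_filter, Finset.sum_const, nsmul_eq_mul, mul_comm]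
  refine mul_le_mul_of_nonneg_right ?_ vonMangoldt_nonneg
  rw [smoothCount_eq_card, Nat.cast_le]
  refine Finset.card_le_card_of_injOn (fun m => d * m) ?_
    fun a _ b _ h => Nat.eq_of_mul_eq_mul_left hd.1 h
  intro m hm
  obtain ⟨h0, hm, hs⟩ := mem_smoothFinset.1 hm
  have hd0 : (0 : ℝ) < d := by exact_mod_cast hd.1
  refine Finset.mem_filter.2 ⟨mem_smoothFinset.2 ⟨Nat.mul_pos hd.1 h0, ?_, ?_⟩,
    Nat.dvd_mul_right _ _⟩
  · rw [le_div_iff₀ hd0] at hm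
    push_cast
    linarith
  · exact (isSmooth_of_le hd.1 ((Nat.le_floor_iff' hd.1.ne').1 hd.2)).mul hs

theorem half_le_smoothCount {x y : ℝ} (hx : 1 ≤ x) (hxy : x ≤ y) :
    x / 2 ≤ smoothCount x y := by
  have hsub : Ioc 0 ⌊x⌋₊ ⊆ smoothFinset x y := by
    intro n hn
    rw [Finset.mem_Ioc] at hn
    have hn' : (n : ℝ) ≤ x := (Nat.le_floor_iff' hn.1.ne').1 hn.2
    exact mem_smoothFinset.2 ⟨hn.1, hn', isSmooth_of_le hn.1 (hn'.trans hxy)⟩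
  have h1 : (⌊x⌋₊ : ℝ) ≤ smoothCount x y := by
    rw [smoothCount_eq_card, Nat.cast_le]
    simpa using Finset.card_le_card hsub
  have h2 : (1 : ℝ) ≤ ⌊x⌋₊ := by exact_mod_cast Nat.floor_pos.2 hx
  linarith [Nat.lt_floor_add_one x]

theorem le_smoothCount_of_log_le {y η c U : ℝ} (hy : 1 < y) (hc : 0 ≤ c)
    (hcU : c ≤ U) (hU : 0 < U)
    (hS : c * Real.log y ≤ ∑ d ∈ Ioc ⌊y ^ (1 - η)⌋₊ ⌊y⌋₊, vonMangoldt d / d) (j : ℕ) :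
    ∀ x : ℝ, 1 ≤ x → Real.log x ≤ (1 + (1 - η) * j) * Real.log y →
      Real.log x ≤ U * Real.log y → x / 2 * (c / U) ^ j ≤ smoothCount x y := by
  have hy0 : 0 < y := one_pos.trans hy
  have hly : 0 < Real.log y := Real.log_pos hy
  have hcU1 : c / U ≤ 1 := (div_le_one hU).2 hcU
  have hcU0 : 0 ≤ c / U := div_nonneg hc hU.le
  induction j with
  | zero =>
    intro x hx h _
    rw [pow_zero, mul_one]
    refine half_le_smoothCount hx ((Real.log_le_log_iff (one_pos.trans_le hx) hy0).1 ?_)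
    simpa using h
  | succ j ih =>
    intro x hx h hxU
    have hx0 : 0 < x := one_pos.trans_le hx
    rcases le_or_gt x y with hxy | hxy
    · refine le_trans ?_ (half_le_smoothCount hx hxy)
      exact mul_le_of_le_one_right (by linarith) (pow_le_one₀ hcU0 hcU1)
    have hlx : 0 < Real.log x := Real.log_pos (hy.trans hxy)
    have hterm : ∀ d ∈ Ioc ⌊y ^ (1 - η)⌋₊ ⌊y⌋₊,
        x / 2 * (c / U) ^ j * (vonMangoldt d / d) ≤ vonMangoldt d * smoothCount (x / d) y := by
      intro d hd
      rw [Finset.mem_Ioc] at hd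
      have hd0 : 0 < d := (Nat.zero_le _).trans_lt hd.1
      have hd0' : (0 : ℝ) < d := by exact_mod_cast hd0
      have hdy : (d : ℝ) ≤ y := (Nat.le_floor_iff' hd0.ne').1 hd.2
      have hdz : y ^ (1 - η) ≤ d := (Nat.lt_of_floor_lt hd.1).le
      have hlz : (1 - η) * Real.log y ≤ Real.log d := by
        rw [← Real.log_rpow hy0]
        exact Real.log_le_log (Real.rpow_pos_of_pos hy0 _) hdz
      have hld : 0 ≤ Real.log d := Real.log_natCast_nonneg d
      have hlxd : Real.log (x / d) = Real.log x - Real.log d :=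
        Real.log_div hx0.ne' hd0'.ne'
      have key := ih (x / d) ((one_le_div hd0').2 (hdy.trans hxy.le))
        (by rw [hlxd]; push_cast at h; linarith) (by rw [hlxd]; linarith)
      calc x / 2 * (c / U) ^ j * (vonMangoldt d / d)
          = vonMangoldt d * (x / d / 2 * (c / U) ^ j) := by ring
        _ ≤ _ := mul_le_mul_of_nonneg_left key vonMangoldt_nonneg
    have hsum : x / 2 * (c / U) ^ j * (c * Real.log y) ≤ smoothCount x y * Real.log x := by
      refine le_trans ?_ (sum_vonMangoldt_mul_smoothCount_le x y)
      refine le_trans (mul_le_mul_of_nonneg_left hS (by positivity)) ?_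
      rw [Finset.mul_sum]
      refine (Finset.sum_le_sum hterm).trans ?_
      exact Finset.sum_le_sum_of_subset_of_nonneg (Finset.Ioc_subset_Ioc_left (Nat.zero_le _))
        fun _ _ _ => mul_nonneg vonMangoldt_nonneg (Nat.cast_nonneg _)
    refine le_of_mul_le_mul_right (le_trans ?_ hsum) hlx
    have h3 : x / 2 * (c / U) ^ (j + 1) * Real.log x
        ≤ x / 2 * (c / U) ^ (j + 1) * (U * Real.log y) :=
      mul_le_mul_of_nonneg_left hxU (by positivity)
    refine h3.trans (le_of_eq ?_)
    rw [pow_succ]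
    field_simp

theorem prod_pow_factorization_eq {s : Finset ℕ} {n : ℕ} (hn : n ≠ 0)
    (h : n.primeFactors ⊆ s) (β : ℝ) :
    ∏ p ∈ s, ((p : ℝ) ^ β) ^ (n.factorization p) = (n : ℝ) ^ β := by
  have h1 : ∏ p ∈ s, p ^ (n.factorization p) = n := by
    rw [← Finsupp.prod_of_support_subset n.factorization h (fun p k => p ^ k)
      (fun _ _ => pow_zero _)]
    exact Nat.prod_factorization_pow_eq_self hn
  conv_rhs => rw [← h1]
  push_cast
  rw [← Real.finsetProd_rpow _ _ fun p _ => by positivity]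
  refine Finset.prod_congr rfl fun p _ => ?_
  rw [← Real.rpow_natCast, ← Real.rpow_natCast, ← Real.rpow_mul (Nat.cast_nonneg p),
    ← Real.rpow_mul (Nat.cast_nonneg p), mul_comm]

theorem sum_pow_factorization_mul_le {f : ℕ → ℝ} {A w : ℝ} {q : ℕ} (hq : q.Prime)
    (hw : 1 ≤ w) (hwq : w < q) (hA : 0 ≤ A) (hf : ∀ m, 0 < m → f (q * m) = f m)
    (hfA : ∀ N : ℕ, ∑ n ∈ Ioc 0 N, f n ≤ A * N) (N : ℕ) :
    ∑ n ∈ Ioc 0 N, w ^ (n.factorization q) * f n ≤ A * (1 + (w - 1) / (q - w)) * N := by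
  have hq0 : (0 : ℝ) < q := by exact_mod_cast hq.pos
  have hqw : 0 < (q : ℝ) - w := sub_pos.2 hwq
  have hc : 0 ≤ (w - 1) / (q - w) := div_nonneg (by linarith) hqw.le
  have hrec : ∀ N : ℕ, ∑ n ∈ Ioc 0 N, (w ^ (n.factorization q) - 1) * f n
      = w * ∑ n ∈ Ioc 0 (N / q), (w ^ (n.factorization q) - 1) * f n
        + (w - 1) * ∑ n ∈ Ioc 0 (N / q), f n := by
    intro N
    have h1 : ∑ n ∈ Ioc 0 N, (w ^ (n.factorization q) - 1) * f n
        = ∑ n ∈ Ioc 0 N with q ∣ n, (w ^ (n.factorization q) - 1) * f n := by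
      rw [Finset.sum_filter]
      refine Finset.sum_congr rfl fun n _ => ?_
      split_ifs with h
      · rfl
      · rw [Nat.factorization_eq_zero_of_not_dvd h, pow_zero, sub_self, zero_mul]
    rw [h1, sum_Ioc_filter_dvd _ _ hq.pos, Finset.mul_sum, Finset.mul_sum,
      ← Finset.sum_add_distrib]
    refine Finset.sum_congr rfl fun m hm => ?_
    have hm0 : 0 < m := (Finset.mem_Ioc.1 hm).1
    have h2 : (q * m).factorization q = m.factorization q + 1 := by
      rw [Nat.factorization_mul hq.ne_zero hm0.ne', Finsupp.add_apply,
        hq.factorization_self, add_comm]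
    rw [h2, hf m hm0, pow_succ]
    ring
  have hH : ∀ N : ℕ, ∑ n ∈ Ioc 0 N, (w ^ (n.factorization q) - 1) * f n
      ≤ A * ((w - 1) / (q - w)) * N := by
    intro N
    induction N using Nat.strong_induction_on with
    | _ N ih =>
      rcases Nat.eq_zero_or_pos N with rfl | hN
      · simp
      have h1 := mul_le_mul_of_nonneg_left (ih (N / q) (Nat.div_lt_self hN hq.one_lt))
        (zero_le_one.trans hw)
      have h2 := mul_le_mul_of_nonneg_left (hfA (N / q)) (sub_nonneg.2 hw)
      rw [hrec]
      refine (add_le_add h1 h2).trans ?_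
      have h3 : ((N / q : ℕ) : ℝ) ≤ N / q := Nat.cast_div_le
      have h4 : w * (A * ((w - 1) / (q - w)) * (N / q : ℕ)) + (w - 1) * (A * (N / q : ℕ))
          = A * (w * ((w - 1) / (q - w)) + (w - 1)) * (N / q : ℕ) := by ring
      have h5 : 0 ≤ A * (w * ((w - 1) / (q - w)) + (w - 1)) := by
        have : 0 ≤ w - 1 := sub_nonneg.2 hw
        positivity
      rw [h4]
      refine (mul_le_mul_of_nonneg_left h3 h5).trans (le_of_eq ?_)
      have := hqw.ne'
      field_simp
      ring
  have hsplit : ∑ n ∈ Ioc 0 N, w ^ (n.factorization q) * f n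
      = ∑ n ∈ Ioc 0 N, (w ^ (n.factorization q) - 1) * f n + ∑ n ∈ Ioc 0 N, f n := by
    rw [← Finset.sum_add_distrib]
    exact Finset.sum_congr rfl fun _ _ => by ring
  rw [hsplit]
  linarith [hH N, hfA N]

theorem sum_prod_pow_factorization_le {w : ℕ → ℝ} (s : Finset ℕ) (hs : ∀ p ∈ s, p.Prime)
    (hw : ∀ p ∈ s, 1 ≤ w p) (hwp : ∀ p ∈ s, w p < p) (N : ℕ) :
    ∑ n ∈ Ioc 0 N, ∏ p ∈ s, w p ^ (n.factorization p)
      ≤ (∏ p ∈ s, (1 + (w p - 1) / (p - w p))) * N := by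
  induction s using Finset.induction_on generalizing N with
  | empty => simp
  | insert q s hqs ih =>
    simp only [Finset.mem_insert, forall_eq_or_imp] at hs hw hwp
    have ih' := ih hs.2 hw.2 hwp.2
    simp only [Finset.prod_insert hqs]
    rw [mul_comm (1 + _)]
    refine sum_pow_factorization_mul_le hs.1 hw.1 hwp.1 ?_ ?_ ih' N
    · refine Finset.prod_nonneg fun p hp => ?_
      have := div_nonneg (sub_nonneg.2 (hw.2 p hp)) (sub_pos.2 (hwp.2 p hp)).le
      linarith
    · intro m hm
      refine Finset.prod_congr rfl fun p hp => ?_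
      have hpq : p ≠ q := fun h => hqs (h ▸ hp)
      rw [Nat.factorization_mul hs.1.ne_zero hm.ne', Finsupp.add_apply, hs.1.factorization,
        Finsupp.single_eq_of_ne hpq, zero_add]

theorem smoothCount_le_of_sum_rpow_le {y β κ P : ℝ} (hβ : 0 ≤ β) (hβ1 : β ≤ 1)
    (hκ : 0 < κ) (hκβ : κ ≤ 1 - 2 ^ (β - 1)) (hP : 0 ≤ P)
    (h : ∀ x : ℝ, 1 ≤ x → ∑ n ∈ smoothFinset x y, (n : ℝ) ^ β ≤ P * x) {x : ℝ} (hx : 0 < x) :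
    (smoothCount x y : ℝ) ≤ 2 / κ * P * x ^ (1 - β) := by
  obtain ⟨k, hk⟩ := pow_unbounded_of_one_lt x one_lt_two
  induction k generalizing x with
  | zero =>
    have h0 : smoothFinset x y = ∅ := by
      refine Finset.eq_empty_of_forall_notMem fun n hn => ?_
      obtain ⟨hn0, hnx, -⟩ := mem_smoothFinset.1 hn
      have : (1 : ℝ) ≤ n := by exact_mod_cast hn0
      rw [pow_zero] at hk
      linarith
    rw [smoothCount_eq_card, h0, Finset.card_empty, Nat.cast_zero]
    positivity
  | succ k ih =>
    rcases lt_or_ge x 1 with hx1 | hx1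
    · exact ih hx (hx1.trans_le (one_le_pow₀ one_le_two))
    have hih := ih (x := x / 2) (by linarith) (by rw [pow_succ] at hk; linarith)
    have hsub : smoothFinset (x / 2) y ⊆ smoothFinset x y := by
      intro n hn
      rw [mem_smoothFinset] at hn ⊢
      exact ⟨hn.1, by linarith [hn.2.1], hn.2.2⟩
    have hcard : ((#(smoothFinset x y \ smoothFinset (x / 2) y) : ℕ) : ℝ) * (x / 2) ^ β
        ≤ P * x := by
      refine le_trans ?_ (h x hx1)
      refine le_trans ?_ (Finset.sum_le_sum_of_subset_of_nonneg
        (Finset.sdiff_subset (t := smoothFinset (x / 2) y))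
        fun n _ _ => Real.rpow_nonneg (Nat.cast_nonneg n) _)
      rw [← nsmul_eq_mul]
      refine Finset.card_nsmul_le_sum _ _ _ fun n hn => ?_
      rw [Finset.mem_sdiff, mem_smoothFinset, mem_smoothFinset] at hn
      refine Real.rpow_le_rpow (by linarith) ?_ hβ
      by_contra! hlt
      exact hn.2 ⟨hn.1.1, hlt.le, hn.1.2.2⟩
    have hsplit : (smoothCount x y : ℝ)
        = #(smoothFinset x y \ smoothFinset (x / 2) y) + smoothCount (x / 2) y := by
      rw [smoothCount_eq_card, smoothCount_eq_card, ← Nat.cast_add,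
        Finset.card_sdiff_add_card_eq_card hsub]
    have hxβ : 0 < x ^ β := Real.rpow_pos_of_pos hx _
    have hdiv : (x / 2) ^ (1 - β) = x ^ (1 - β) * 2 ^ (β - 1) := by
      rw [Real.div_rpow hx.le zero_le_two, div_eq_mul_inv, ← Real.rpow_neg zero_le_two,
        neg_sub]
    have hx1β : x ^ (1 - β) = x / x ^ β := by
      rw [Real.rpow_sub hx, Real.rpow_one]
    have h2β : (2 : ℝ) ^ β ≤ 2 := by
      simpa using Real.rpow_le_rpow_of_exponent_le one_le_two hβ1
    have hnew : ((#(smoothFinset x y \ smoothFinset (x / 2) y) : ℕ) : ℝ)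
        ≤ 2 * P * x ^ (1 - β) := by
      rw [Real.div_rpow hx.le zero_le_two, mul_div_assoc', div_le_iff₀ (by positivity)] at hcard
      rw [hx1β, mul_div_assoc', le_div_iff₀ hxβ]
      refine hcard.trans ?_
      calc P * x * 2 ^ β ≤ P * x * 2 := by gcongr
        _ = 2 * P * x := by ring
    rw [hdiv] at hih
    rw [hsplit]
    have hfac : 2 / κ * P * (x ^ (1 - β) * 2 ^ (β - 1))
        ≤ 2 / κ * P * (x ^ (1 - β) * (1 - κ)) := by
      have : (2 : ℝ) ^ (β - 1) ≤ 1 - κ := by linarith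
      gcongr
    have heq : 2 / κ * P * (x ^ (1 - β) * (1 - κ)) + 2 * P * x ^ (1 - β)
        = 2 / κ * P * x ^ (1 - β) := by
      field_simp
      ring
    linarith

theorem smoothCount_rpow_le {ε : ℝ} (hε : 0 < ε) {u y : ℝ} (hu : 1 < u) (hy : 3 ≤ y)
    (huy : Real.log u ≤ (1 - ε) * Real.log y) :
    (smoothCount (y ^ u) y : ℝ) ≤ 2 / (1 - 2 ^ (-ε)) * Real.exp (7 / (1 - 2 ^ (-ε)) * u)
      * (y ^ u / u ^ u) := by
  set κ : ℝ := 1 - 2 ^ (-ε) with hκdef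
  have hκ : 0 < κ := by
    have : (2 : ℝ) ^ (-ε) < 1 := Real.rpow_lt_one_of_one_lt_of_neg one_lt_two (by linarith)
    linarith
  have hy0 : 0 < y := by linarith
  have hly1 : 1 ≤ Real.log y := by
    rw [Real.le_log_iff_exp_le hy0]
    linarith [Real.exp_one_lt_d9]
  have hly : 0 < Real.log y := by linarith
  have hlu : 0 < Real.log u := Real.log_pos hu
  set β : ℝ := Real.log u / Real.log y with hβdef
  have hβ0 : 0 ≤ β := by positivity
  have hβε : β ≤ 1 - ε := (div_le_iff₀ hly).2 huy
  have hexp : ∀ p : ℝ, 2 ≤ p → p ^ (β - 1) ≤ 1 - κ := by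
    intro p hp
    calc p ^ (β - 1) ≤ 2 ^ (β - 1) :=
          Real.rpow_le_rpow_of_nonpos two_pos hp (by linarith)
      _ ≤ 2 ^ (-ε) := Real.rpow_le_rpow_of_exponent_le one_le_two (by linarith)
      _ = 1 - κ := by rw [hκdef]; ring
  set s := Nat.primesLE ⌊y⌋₊ with hs
  have hsp : ∀ p ∈ s, p.Prime := fun p hp => Nat.prime_of_mem_primesLE hp
  have hs2 : ∀ p ∈ s, (2 : ℝ) ≤ p := fun p hp => by exact_mod_cast (hsp p hp).two_le
  have hw1 : ∀ p ∈ s, 1 ≤ (p : ℝ) ^ β := fun p hp =>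
    Real.one_le_rpow (by linarith [hs2 p hp]) hβ0
  have hden : ∀ p ∈ s, (p : ℝ) * κ ≤ p - (p : ℝ) ^ β := by
    intro p hp
    have hp0 : (0 : ℝ) < p := by linarith [hs2 p hp]
    have h1 := mul_le_mul_of_nonneg_left (hexp p (hs2 p hp)) hp0.le
    rw [Real.rpow_sub_one hp0.ne', mul_div_cancel₀ _ hp0.ne'] at h1
    linarith
  have hwp : ∀ p ∈ s, (p : ℝ) ^ β < p := by
    intro p hp
    have hp0 : (0 : ℝ) < p := by linarith [hs2 p hp]
    linarith [hden p hp, mul_pos hp0 hκ]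
  set P : ℝ := ∏ p ∈ s, (1 + ((p : ℝ) ^ β - 1) / (p - (p : ℝ) ^ β)) with hPdef
  have hterm : ∀ p ∈ s, 0 ≤ ((p : ℝ) ^ β - 1) / (p - (p : ℝ) ^ β) := fun p hp =>
    div_nonneg (sub_nonneg.2 (hw1 p hp)) (sub_pos.2 (hwp p hp)).le
  have hP0 : 0 ≤ P := Finset.prod_nonneg fun p hp => by linarith [hterm p hp]
  have hPle : P ≤ Real.exp (7 / κ * u) := by
    have h1 : P ≤ Real.exp (∑ p ∈ s, ((p : ℝ) ^ β - 1) / (p - (p : ℝ) ^ β)) := by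
      rw [Real.exp_sum]
      refine Finset.prod_le_prod (fun p hp => by linarith [hterm p hp]) fun p _ => ?_
      rw [add_comm]
      exact Real.add_one_le_exp _
    refine h1.trans (Real.exp_le_exp.2 ?_)
    have h2 : ∀ p ∈ s, ((p : ℝ) ^ β - 1) / (p - (p : ℝ) ^ β)
        ≤ u / (κ * Real.log y) * (Real.log p / p) := by
      intro p hp
      have hp0 : (0 : ℝ) < p := by linarith [hs2 p hp]
      have hlp : 0 ≤ Real.log p := Real.log_natCast_nonneg p
      have hpy : Real.log p ≤ Real.log y := Real.log_le_log hp0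
        ((Nat.le_floor_iff' (hsp p hp).ne_zero).1 (Nat.le_of_mem_primesLE hp))
      have h3 : (p : ℝ) ^ β ≤ 1 + Real.log p / Real.log y * (u - 1) := by
        have h4 : (p : ℝ) ^ β = (1 + (u - 1)) ^ (Real.log p / Real.log y) := by
          rw [add_sub_cancel, Real.rpow_def_of_pos hp0, Real.rpow_def_of_pos (by linarith)]
          congr 1
          rw [hβdef]
          ring
        rw [h4]
        exact rpow_one_add_le_one_add_mul_self (by linarith) (by positivity)
          ((div_le_one hly).2 hpy)
      calc ((p : ℝ) ^ β - 1) / (p - (p : ℝ) ^ β)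
          ≤ (Real.log p / Real.log y * u) / (p * κ) := by
            refine div_le_div₀ (by positivity) ?_ (by positivity) (hden p hp)
            have : 0 ≤ Real.log p / Real.log y := by positivity
            linarith
        _ = _ := by field_simp
    refine (Finset.sum_le_sum h2).trans ?_
    rw [← Finset.mul_sum]
    refine (mul_le_mul_of_nonneg_left (sum_log_prime_div_le (by linarith))
      (by positivity)).trans ?_
    rw [div_mul_eq_mul_div, div_mul_eq_mul_div, div_le_div_iff₀ (by positivity) hκ]
    have : u * κ * (Real.log y + 6) ≤ u * κ * (7 * Real.log y) := by
      gcongr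
      linarith
    linarith
  have hsum : ∀ x : ℝ, 1 ≤ x → ∑ n ∈ smoothFinset x y, (n : ℝ) ^ β ≤ P * x := by
    intro x hx
    have h1 := sum_prod_pow_factorization_le s hsp hw1 hwp ⌊x⌋₊
    refine le_trans ?_ (h1.trans
      (mul_le_mul_of_nonneg_left (Nat.floor_le (by linarith)) hP0))
    have h2 : ∀ n ∈ smoothFinset x y,
        (n : ℝ) ^ β = ∏ p ∈ s, ((p : ℝ) ^ β) ^ (n.factorization p) := by
      intro n hn
      obtain ⟨hn0, -, hn⟩ := mem_smoothFinset.1 hn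
      refine (prod_pow_factorization_eq hn0.ne' (fun p hp => ?_) β).symm
      have hpp := Nat.prime_of_mem_primeFactors hp
      exact Nat.mem_primesLE.2 ⟨(Nat.le_floor_iff' hpp.ne_zero).2
        (hn p hpp (Nat.dvd_of_mem_primeFactors hp)), hpp⟩
    rw [Finset.sum_congr rfl h2]
    refine Finset.sum_le_sum_of_subset_of_nonneg (fun n hn => ?_)
      fun n _ _ => Finset.prod_nonneg fun p _ => by positivity
    obtain ⟨hn0, hn, -⟩ := mem_smoothFinset.1 hn
    exact Finset.mem_Ioc.2 ⟨hn0, (Nat.le_floor_iff' hn0.ne').2 hn⟩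
  have hmain := smoothCount_le_of_sum_rpow_le hβ0 (by linarith) hκ
    (by linarith [hexp 2 le_rfl]) hP0 hsum (Real.rpow_pos_of_pos hy0 u)
  have hpow : (y ^ u) ^ (1 - β) = y ^ u / u ^ u := by
    rw [Real.rpow_sub (Real.rpow_pos_of_pos hy0 u), Real.rpow_one]
    congr 1
    rw [← Real.rpow_mul hy0.le, Real.rpow_def_of_pos hy0,
      Real.rpow_def_of_pos (zero_lt_one.trans hu)]
    congr 1
    rw [hβdef]
    field_simp
  rw [hpow] at hmain
  refine hmain.trans ?_
  have : 0 ≤ y ^ u / u ^ u := by positivity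
  gcongr

theorem le_log_div_smoothCount {ε : ℝ} (hε : 0 < ε) :
    ∃ C : ℝ, ∀ u y : ℝ, 1 < u → 3 ≤ y → Real.log u ≤ (1 - ε) * Real.log y →
      u * Real.log u - C * u ≤ Real.log (y ^ u / smoothCount (y ^ u) y) := by
  refine ⟨7 / (1 - 2 ^ (-ε)) + |Real.log (2 / (1 - 2 ^ (-ε)))|, fun u y hu hy huy => ?_⟩
  have hκ : (0 : ℝ) < 1 - 2 ^ (-ε) :=
    sub_pos.2 (Real.rpow_lt_one_of_one_lt_of_neg one_lt_two (by linarith))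
  have hy0 : 0 < y := by linarith
  have hu0 : 0 < u := by linarith
  have hx : 0 < y ^ u := Real.rpow_pos_of_pos hy0 u
  have huu : 0 < u ^ u := Real.rpow_pos_of_pos hu0 u
  have hpos : (0 : ℝ) < smoothCount (y ^ u) y := by
    exact_mod_cast smoothCount_pos (Real.one_le_rpow (by linarith) hu0.le) y
  have h := Real.log_le_log hpos (smoothCount_rpow_le hε hu hy huy)
  rw [Real.log_mul (by positivity) (by positivity), Real.log_mul (by positivity) (by positivity),
    Real.log_exp, Real.log_div hx.ne' huu.ne', Real.log_rpow hu0] at h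
  rw [Real.log_div hx.ne' hpos.ne']
  set K := Real.log (2 / (1 - 2 ^ (-ε)))
  have hK : K ≤ |K| * u := (le_abs_self K).trans (le_mul_of_one_le_right (abs_nonneg K) hu.le)
  linarith

theorem log_div_smoothCount_le {η : ℝ} (hη : 0 < η) (hη1 : η < 1) {u y : ℝ} (hu : 1 < u)
    (hy : 22 / η ≤ Real.log y) (hy0 : 0 < y) :
    Real.log (y ^ u / smoothCount (y ^ u) y)
      ≤ Real.log 2 + (u / (1 - η) + 1) * (Real.log u + Real.log (2 / η)) := by
  have hu0 : 0 < u := by linarith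
  have hly : 0 < Real.log y := lt_of_lt_of_le (by positivity) hy
  have hy1 : 1 < y := (Real.log_pos_iff hy0.le).1 hly
  have hη' : 0 < 1 - η := sub_pos.2 hη1
  have hx : 0 < y ^ u := Real.rpow_pos_of_pos hy0 u
  have hx1 : 1 ≤ y ^ u := Real.one_le_rpow hy1.le hu0.le
  have hS : η / 2 * Real.log y ≤ ∑ d ∈ Ioc ⌊y ^ (1 - η)⌋₊ ⌊y⌋₊, vonMangoldt d / d := by
    refine le_trans ?_ (le_sum_vonMangoldt_div_Ioc (Real.one_le_rpow hy1.le hη'.le)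
      (Real.rpow_le_self_of_one_le hy1.le (by linarith)))
    rw [Real.log_rpow hy0]
    rw [div_le_iff₀ hη] at hy
    linarith
  set j : ℕ := ⌈u / (1 - η)⌉₊ with hj
  have hj1 : (j : ℝ) ≤ u / (1 - η) + 1 := (Nat.ceil_lt_add_one (by positivity)).le
  have hj2 : u ≤ (1 - η) * j := by
    have := Nat.le_ceil (u / (1 - η))
    rw [div_le_iff₀ hη'] at this
    linarith
  have hlow := le_smoothCount_of_log_le hy1 (by positivity) (by linarith) hu0 hS j (y ^ u) hx1
    (by
      rw [Real.log_rpow hy0]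
      exact mul_le_mul_of_nonneg_right (by linarith) hly.le)
    (by rw [Real.log_rpow hy0])
  have hpos : (0 : ℝ) < smoothCount (y ^ u) y := by exact_mod_cast smoothCount_pos hx1 y
  have h := Real.log_le_log (by positivity) hlow
  have hc : Real.log (η / 2 / u) = -(Real.log u + Real.log (2 / η)) := by
    rw [← Real.log_mul hu0.ne' (by positivity), ← Real.log_inv]
    congr 1
    field_simp
  rw [Real.log_mul (by positivity) (by positivity), Real.log_pow, hc,
    Real.log_div hx.ne' two_ne_zero] at h
  rw [Real.log_div hx.ne' hpos.ne']
  have hD : 0 ≤ Real.log u + Real.log (2 / η) :=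
    add_nonneg (Real.log_nonneg hu.le) (Real.log_nonneg ((one_le_div hη).2 (by linarith)))
  have := mul_le_mul_of_nonneg_right hj1 hD
  linarith

/-- Canfield–Erdős–Pomerance: for fixed `0 < ε < 1`,
`Ψ(x, x^(1/u)) = x·u^(-u(1+o(1)))` as `u → ∞` and `x^(1/u) → ∞`, uniformly
in the region `x ≥ u^(u/(1-ε))`. -/
theorem stmt_17 (ε : ℝ) (hε0 : 0 < ε) (hε1 : ε < 1) :
    ∀ δ : ℝ, 0 < δ →
      ∃ u₀ y₀ : ℝ, ∀ u x : ℝ, u₀ ≤ u → y₀ ≤ x ^ (1 / u) →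
        u ^ (u / (1 - ε)) ≤ x →
        |Real.log (x / smoothCount x (x ^ (1 / u))) / (u * Real.log u) - 1| ≤ δ := by
  intro δ hδ
  obtain ⟨C, hC⟩ := le_log_div_smoothCount hε0
  set η : ℝ := δ / (2 + δ) with hη
  have hη0 : 0 < η := by positivity
  have hη1 : η < 1 := (div_lt_one (by positivity)).2 (by linarith)
  have hηinv : ∀ u : ℝ, u / (1 - η) = u * (1 + δ / 2) := by
    intro u
    have : 1 - η = 2 / (2 + δ) := by
      rw [hη]
      field_simp
      ring
    rw [this]
    field_simp
  set D : ℝ := Real.log (2 / η) with hD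
  have hD0 : 0 ≤ D := Real.log_nonneg ((one_le_div hη0).2 (by linarith))
  refine ⟨max (max 2 (4 / δ)) (max (Real.exp (4 / δ * (1 + D + (1 + δ / 2) * D)))
    (Real.exp (C / δ))), max 3 (Real.exp (22 / η)), fun u x hu hy hx => ?_⟩
  simp only [max_le_iff] at hu hy
  obtain ⟨⟨hu2, huδ⟩, huD, huC⟩ := hu
  obtain ⟨hy3, hyη⟩ := hy
  have hu0 : 0 < u := by linarith
  have hx0 : 0 < x := (Real.rpow_pos_of_pos hu0 _).trans_le hx
  have hlu : 0 < Real.log u := Real.log_pos (by linarith)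
  have hε : 0 < 1 - ε := sub_pos.2 hε1
  set y : ℝ := x ^ (1 / u) with hydef
  have hy0 : 0 < y := by linarith
  have hxy : x = y ^ u := by
    rw [hydef, ← Real.rpow_mul hx0.le, one_div_mul_cancel hu0.ne', Real.rpow_one]
  have huy : Real.log u ≤ (1 - ε) * Real.log y := by
    have h := Real.log_le_log (Real.rpow_pos_of_pos hu0 _) hx
    rw [Real.log_rpow hu0, hxy, Real.log_rpow hy0, div_mul_eq_mul_div, div_le_iff₀ hε,
      mul_assoc] at h
    rw [mul_comm]
    exact le_of_mul_le_mul_left h hu0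
  have hlow := hC u y (by linarith) hy3 huy
  have hup := log_div_smoothCount_le hη0 hη1 (u := u) (by linarith)
    ((Real.le_log_iff_exp_le hy0).2 hyη) hy0
  rw [hηinv, ← hD] at hup
  rw [← Real.le_log_iff_exp_le hu0] at huD huC
  rw [← hxy] at hlow hup
  have hul : 0 < u * Real.log u := mul_pos hu0 hlu
  have hCu : C * u ≤ δ * (u * Real.log u) := by
    rw [div_le_iff₀ hδ] at huC
    calc C * u ≤ Real.log u * δ * u := mul_le_mul_of_nonneg_right huC hu0.le
      _ = _ := by ring
  have hDu : (1 + D + (1 + δ / 2) * D) * u ≤ δ / 4 * (u * Real.log u) := by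
    rw [div_mul_eq_mul_div, div_le_iff₀ hδ] at huD
    have := mul_le_mul_of_nonneg_right huD hu0.le
    linarith
  have hlogu : Real.log u ≤ δ / 4 * (u * Real.log u) := by
    rw [div_le_iff₀ hδ] at huδ
    have := mul_le_mul_of_nonneg_right huδ hlu.le
    linarith
  have hrest : 1 + D ≤ (1 + D) * u := le_mul_of_one_le_right (by positivity) (by linarith)
  have hlog2 : Real.log 2 ≤ 1 := by linarith [Real.log_two_lt_d9]
  rw [div_sub_one hul.ne', abs_div, abs_of_pos hul, div_le_iff₀ hul, abs_le]
  constructor <;> linarith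
end
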